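/- arXiv:1507.08082 — 2 statements merged into one kernel-verified Lean document; each statement's English description precedes it below -/
import Mathlib

section
/- Every finite strongly connected directed graph admits, for every ε > 0, a flow f satisfying conservation at every node with f(l) > ε for every link l. -/
open Finset

/-- A flow on a directed graph (given by `tail`/`head` maps on links) is a real-valued
function on links satisfying conservation at every node: total flow on links with head `n`
equals total flow on links with tail `n`. -/
def IsFlow {N L : Type} [Fintype L] [DecidableEq N]
    (tail head : L → N) (f : L → ℝ) : Prop :=
  ∀ n : N, ∑ l ∈ Finset.univ.filter (fun l => head l = n), f l
         = ∑ l ∈ Finset.univ.filter (fun l => tail l = n), f l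

/-- A directed graph is strongly connected if for every ordered pair of nodes there is a
directed walk from the first to the second. -/
def StronglyConnected {N L : Type} (tail head : L → N) : Prop :=
  ∀ a b : N, ∃ (k : ℕ) (nodes : Fin (k + 1) → N) (links : Fin k → L),
    nodes 0 = a ∧ nodes (Fin.last k) = b ∧
    ∀ i : Fin k, tail (links i) = nodes i.castSucc ∧ head (links i) = nodes i.succ

/-- `InUndirectedCycle tail head U e`: link `e` lies on an undirected cycle (a closed walk
with pairwise distinct links, directions ignored) all of whose links belong to `U`. -/
def InUndirectedCycle {N L : Type} (tail head : L → N) (U : Set L) (e : L) : Prop :=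
  ∃ (k : ℕ) (links : Fin (k + 1) → L) (dir : Fin (k + 1) → Bool) (nodes : Fin (k + 2) → N),
    Function.Injective links ∧
    (∀ i, links i ∈ U) ∧
    nodes 0 = nodes (Fin.last (k + 1)) ∧
    (∀ i : Fin (k + 1),
      (tail (links i), head (links i)) =
        (if dir i then (nodes i.castSucc, nodes i.succ)
          else (nodes i.succ, nodes i.castSucc))) ∧
    (∃ i, links i = e)

/-- The set `U` of links contains an undirected cycle. -/
def HasUndirectedCycleIn {N L : Type} (tail head : L → N) (U : Set L) : Prop :=
  ∃ e, InUndirectedCycle tail head U e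

/-- Link `e` is identifiable from the measured set `M`: any two nonnegative flows that agree
on every link of `M` agree on `e`. -/
def Identifiable {N L : Type} [Fintype L] [DecidableEq N]
    (tail head : L → N) (M : Set L) (e : L) : Prop :=
  ∀ f g : L → ℝ, IsFlow tail head f → IsFlow tail head g →
    (∀ l, 0 ≤ f l) → (∀ l, 0 ≤ g l) →
    (∀ l ∈ M, f l = g l) → f e = g e

/-- The number of times each link is used by a walk balances at every node, up to the
endpoints of the walk. -/
theorem sum_walk_count_head_add_eq {N L : Type} [Fintype L] [DecidableEq N] [DecidableEq L]
    (tail head : L → N) {k : ℕ} (nodes : Fin (k + 1) → N) (links : Fin k → L)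
    (h : ∀ i : Fin k, tail (links i) = nodes i.castSucc ∧ head (links i) = nodes i.succ) (n : N) :
    ∑ l with head l = n, ∑ i, (if links i = l then (1 : ℝ) else 0)
        + (if nodes 0 = n then 1 else 0)
      = ∑ l with tail l = n, ∑ i, (if links i = l then (1 : ℝ) else 0)
        + (if nodes (Fin.last k) = n then 1 else 0) := by
  have key := (Fin.sum_univ_succ fun j => if nodes j = n then (1 : ℝ) else 0).symm.trans
    (Fin.sum_univ_castSucc fun j => if nodes j = n then (1 : ℝ) else 0)
  rw [Finset.sum_comm, Finset.sum_comm (s := univ.filter fun l => tail l = n)]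
  simp only [Finset.sum_ite_eq, Finset.mem_filter, Finset.mem_univ, true_and, h]
  linarith

/-- In a strongly connected graph every link carries at least one unit of some
nonnegative flow. -/
theorem StronglyConnected.exists_flow_one_le {N L : Type} [Fintype L] [DecidableEq N]
    [DecidableEq L] {tail head : L → N} (hsc : StronglyConnected tail head) (e : L) :
    ∃ f : L → ℝ, IsFlow tail head f ∧ (∀ l, 0 ≤ f l) ∧ 1 ≤ f e := by
  obtain ⟨k, nodes, links, h0, hk, h⟩ := hsc (head e) (tail e)
  have hnonneg : ∀ l, 0 ≤ ∑ i, (if links i = l then (1 : ℝ) else 0) := fun l =>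
    Finset.sum_nonneg fun i _ => by split_ifs <;> norm_num
  refine ⟨fun l => ∑ i, (if links i = l then (1 : ℝ) else 0) + if e = l then 1 else 0,
    fun n => ?_, fun l => ?_, ?_⟩
  · have key := sum_walk_count_head_add_eq tail head nodes links h n
    rw [h0, hk] at key
    simp only [Finset.sum_add_distrib, Finset.sum_ite_eq, Finset.mem_filter, Finset.mem_univ,
      true_and]
    exact key
  · exact add_nonneg (hnonneg l) (by split_ifs <;> norm_num)
  · simp

/-- A finite strongly connected directed graph admits, for every `ε > 0`,
a flow whose value exceeds `ε` on every link. -/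
theorem exists_flow_gt_of_stronglyConnected
    {N L : Type} [Fintype N] [Fintype L] [DecidableEq N] [DecidableEq L]
    (tail head : L → N) (hsc : StronglyConnected tail head)
    (ε : ℝ) (hε : 0 < ε) :
    ∃ f : L → ℝ, IsFlow tail head f ∧ ∀ l, ε < f l := by
  choose F hF hF0 hF1 using fun e => hsc.exists_flow_one_le e
  refine ⟨fun l => (ε + 1) * ∑ e, F e l, fun n => ?_, fun l => ?_⟩
  · rw [← Finset.mul_sum, ← Finset.mul_sum, Finset.sum_comm,
      Finset.sum_comm (s := univ.filter fun l => tail l = n)]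
    exact congrArg _ (Finset.sum_congr rfl fun e _ => hF e n)
  · have hl : 1 ≤ ∑ e, F e l :=
      (hF1 l).trans (Finset.single_le_sum (fun e _ => hF0 e l) (Finset.mem_univ l))
    nlinarith
end

section
/- (Known turn ratios.) Let G = (N, L) be a finite directed graph, M ⊆ L, U = L \ M. Let e₁, …, e_k ∈ U be all the links with tail at a common node, and suppose flows are additionally constrained to satisfy f(e_j) = r_j · s for all j, where r_1, …, r_k are fixed ratios with r_j > 0 and r_1 + ⋯ + r_k = 1 and s is the total outflow at that node. If some link e_i among them does not belong to any undirected cycle consisting entirely of links from U, then all the flows f(e_1), …, f(e_k) are determined: any two nonnegative flows satisfying conservation and the ratio constraints that agree on every link of M agree on every e_j. -/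
open Finset

/-- The simple graph on the nodes of a directed graph that joins two distinct nodes whenever some
link in `U` connects them in one of the two directions. -/
def linkGraph {N L : Type} (tail head : L → N) (U : Set L) : SimpleGraph N :=
  SimpleGraph.fromRel fun a b => ∃ l ∈ U, tail l = a ∧ head l = b

/-- A link of `U` whose end nodes are joined through other links of `U` lies on an undirected
cycle in `U`. -/
lemma inUndirectedCycle_of_reachable {N L : Type} {tail head : L → N} {U : Set L} {e : L}
    (he : e ∈ U) (h : (linkGraph tail head (U \ {e})).Reachable (head e) (tail e)) :
    InUndirectedCycle tail head U e := by
  classical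
  obtain ⟨p, hp⟩ := h.exists_isPath
  have hstep : ∀ i : Fin p.length, ∃ l ∈ U \ {e}, ∃ b : Bool, (tail l, head l) =
      if b then (p.getVert i, p.getVert (i + 1)) else (p.getVert (i + 1), p.getVert i) := by
    intro i
    obtain ⟨-, ⟨l, hl, ht, hh⟩ | ⟨l, hl, ht, hh⟩⟩ :=
      (SimpleGraph.fromRel_adj _ _ _).mp (p.adj_getVert_succ i.isLt)
    · exact ⟨l, hl, true, by simp [ht, hh]⟩
    · exact ⟨l, hl, false, by simp [ht, hh]⟩
  choose links hmem dir hlink using hstep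
  have hinj : Function.Injective links := by
    intro i j hij
    have hi := hlink i
    rw [hij, hlink j] at hi
    have key : ∀ a b : ℕ, a ≤ p.length → b ≤ p.length → p.getVert a = p.getVert b → a = b :=
      fun a b ha hb hab => hp.getVert_injOn ha hb hab
    have hsucc := i.isLt
    have hsucc' := j.isLt
    have h₁ := key i j (by omega) (by omega)
    have h₂ := key i (j + 1) (by omega) (by omega)
    have h₃ := key (i + 1) j (by omega) (by omega)
    ext
    cases hdi : dir i <;> cases hdj : dir j <;> simp [hdi, hdj] at hi <;> grind
  refine ⟨p.length, Fin.cons e links, Fin.cons true dir,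
    Fin.cons (tail e) fun j : Fin (p.length + 1) => p.getVert j, ?_, ?_, ?_, ?_, 0, rfl⟩
  · refine Fin.cons_injective_iff.mpr ⟨?_, hinj⟩
    rintro ⟨j, hj⟩
    exact (hmem j).2 hj
  · exact Fin.cases he fun j => (hmem j).1
  · simp [← Fin.succ_last]
  · refine Fin.cases ?_ fun j => ?_
    · simp
    · simpa [← Fin.succ_castSucc] using hlink j

lemma IsFlow.sub {N L : Type} [Fintype L] [DecidableEq N] {tail head : L → N} {f g : L → ℝ}
    (hf : IsFlow tail head f) (hg : IsFlow tail head g) : IsFlow tail head (f - g) := by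
  intro n
  simp [Finset.sum_sub_distrib, hf n, hg n]

/-- The total flow into the nodes of `S` equals the total flow out of the nodes of `S`. -/
lemma IsFlow.sum_head_mem_eq_sum_tail_mem {N L : Type} [Fintype L] [DecidableEq N]
    {tail head : L → N} {f : L → ℝ} (hf : IsFlow tail head f) (S : Finset N) :
    ∑ l with head l ∈ S, f l = ∑ l with tail l ∈ S, f l := by
  have hfiber (t : L → N) : ∑ l with t l ∈ S, f l = ∑ n ∈ S, ∑ l with t l = n, f l := by
    simp only [Finset.sum_filter]
    rw [Finset.sum_comm]
    simp
  rw [hfiber, hfiber]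
  exact Finset.sum_congr rfl fun n _ => hf n

/-- A flow supported on `U` vanishes on every link that lies on no undirected cycle in `U`. -/
lemma IsFlow.eq_zero_of_not_inUndirectedCycle {N L : Type} [Fintype N] [Fintype L] [DecidableEq N]
    {tail head : L → N} {U : Set L} {f : L → ℝ} (hf : IsFlow tail head f)
    (hU : ∀ l ∉ U, f l = 0) {e : L} (he : ¬ InUndirectedCycle tail head U e) : f e = 0 := by
  classical
  by_cases heU : e ∈ U
  swap
  · exact hU e heU
  let G := linkGraph tail head (U \ {e})
  let S : Finset N := {n | G.Reachable (head e) n}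
  have hhead : head e ∈ S := by simp [S]
  have htail : tail e ∉ S := fun h =>
    he (inUndirectedCycle_of_reachable heU (by simpa [S] using h))
  have hsame : ∀ l ∈ U, l ≠ e → (head l ∈ S ↔ tail l ∈ S) := by
    intro l hl hle
    by_cases hloop : tail l = head l
    · rw [hloop]
    have hadj : G.Adj (tail l) (head l) :=
      (SimpleGraph.fromRel_adj _ _ _).mpr ⟨hloop, Or.inl ⟨l, ⟨hl, hle⟩, rfl, rfl⟩⟩
    simp only [S, Finset.mem_filter, Finset.mem_univ, true_and]
    exact ⟨fun h => h.trans hadj.symm.reachable, fun h => h.trans hadj.reachable⟩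
  have hsum := hf.sum_head_mem_eq_sum_tail_mem S
  rw [Finset.sum_filter, Finset.sum_filter, ← sub_eq_zero, ← Finset.sum_sub_distrib,
    Finset.sum_eq_single e] at hsum
  · simpa [hhead, htail] using hsum
  · intro l _ hle
    by_cases hl : l ∈ U
    · simp [hsame l hl hle]
    · simp [hU l hl]
  · simp

/-- **known turn ratios.** Let `e 0, …, e (k-1)` be all the (unmeasured)
links with tail at a common node `n0`, and suppose flows are additionally constrained by
known turn ratios `r j > 0` with `∑ j, r j = 1`: `f (e j) = r j * s` where `s` is the total
outflow at `n0`.  If some `e i` lies on no undirected cycle of unmeasured links, then all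
the flows `f (e j)` are determined by the measurements. -/
theorem turn_ratio_identifiability
    {N L : Type} [Fintype N] [Fintype L] [DecidableEq N] [DecidableEq L]
    (tail head : L → N) (M : Set L) (n0 : N)
    (k : ℕ) (e : Fin k → L) (hinj : Function.Injective e)
    (htails : ∀ j, tail (e j) = n0)
    (hcover : ∀ l : L, tail l = n0 → ∃ j, e j = l)
    (hunmeasured : ∀ j, e j ∉ M)
    (r : Fin k → ℝ) (hrpos : ∀ j, 0 < r j) (hrsum : ∑ j, r j = 1)
    (i : Fin k) (hi : ¬ InUndirectedCycle tail head Mᶜ (e i))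
    (f g : L → ℝ)
    (hf : IsFlow tail head f) (hg : IsFlow tail head g)
    (hfnn : ∀ l, 0 ≤ f l) (hgnn : ∀ l, 0 ≤ g l)
    (hfr : ∀ j, f (e j) = r j * ∑ l ∈ Finset.univ.filter (fun l => tail l = n0), f l)
    (hgr : ∀ j, g (e j) = r j * ∑ l ∈ Finset.univ.filter (fun l => tail l = n0), g l)
    (hagree : ∀ l ∈ M, f l = g l) :
    ∀ j, f (e j) = g (e j) := by
  have hfg : f (e i) = g (e i) := sub_eq_zero.mp <|
    (hf.sub hg).eq_zero_of_not_inUndirectedCycle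
      (fun l hl => sub_eq_zero.mpr (hagree l (Set.notMem_compl_iff.mp hl))) hi
  rw [hfr, hgr] at hfg
  have htotal := mul_left_cancel₀ (hrpos i).ne' hfg
  intro j
  rw [hfr, hgr, htotal]
end
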